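/- Let 𝓗 be a complex Hilbert space, ℓ₀, m₀ > 0, κ ∈ (0,1), and let G : 𝓗 → 𝓗 be a continuous linear operator with ℓ₀·‖x‖² ≤ Re⟨G x, x⟩ for all x and with operator norm ‖G‖ ≤ m₀. Let τ_R ≥ 1, |τ_I| ≤ κ·τ_R, and let H := (τ_R²−τ_I²)·G + I, which is invertible with ‖H⁻¹‖ ≤ ((1−κ²)·ℓ₀·τ_R² + 1)^{-1}. Then ‖2·τ_R·τ_I·(H⁻¹ ∘ G)‖ ≤ 2·κ·m₀·τ_R² / ((1−κ²)·ℓ₀·τ_R² + 1); moreover, if 2·κ·m₀ < (1−κ²)·ℓ₀, then the operator I + 2·i·τ_R·τ_I·(H⁻¹ ∘ G) is invertible in the algebra of continuous linear operators on 𝓗. -/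

import Mathlib

/-- Norm bound for `2 τ_R τ_I H⁻¹ G` where `H = (τ_R² - τ_I²) G + I`, and invertibility
of `I + 2 i τ_R τ_I H⁻¹ G` via the Neumann series when `2 κ m₀ < (1-κ²) ℓ₀`. -/
theorem stmt_7 {𝓗 : Type*} [NormedAddCommGroup 𝓗] [InnerProductSpace ℂ 𝓗] [CompleteSpace 𝓗]
    (G : 𝓗 →L[ℂ] 𝓗) (ℓ₀ m₀ κ τR τI : ℝ)
    (hℓ : 0 < ℓ₀) (hm : 0 < m₀) (hκ : κ ∈ Set.Ioo (0 : ℝ) 1)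
    (hG : ∀ x : 𝓗, ℓ₀ * ‖x‖ ^ 2 ≤ (inner ℂ (G x) x : ℂ).re)
    (hGnorm : ‖G‖ ≤ m₀)
    (hτR : 1 ≤ τR) (hτI : |τI| ≤ κ * τR)
    (Hinv : 𝓗 →L[ℂ] 𝓗)
    (hinv1 : ∀ x, Hinv ((((τR ^ 2 - τI ^ 2 : ℝ) : ℂ) • G + ContinuousLinearMap.id ℂ 𝓗) x) = x)
    (hinv2 : ∀ x, (((τR ^ 2 - τI ^ 2 : ℝ) : ℂ) • G + ContinuousLinearMap.id ℂ 𝓗) (Hinv x) = x)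
    (hinvnorm : ‖Hinv‖ ≤ ((1 - κ ^ 2) * ℓ₀ * τR ^ 2 + 1)⁻¹) :
    ‖((2 * τR * τI : ℝ) : ℂ) • (Hinv ∘L G)‖ ≤
        2 * κ * m₀ * τR ^ 2 / ((1 - κ ^ 2) * ℓ₀ * τR ^ 2 + 1) ∧
      (2 * κ * m₀ < (1 - κ ^ 2) * ℓ₀ →
        IsUnit ((1 : 𝓗 →L[ℂ] 𝓗) +
          (2 * Complex.I * (τR : ℂ) * (τI : ℂ)) • (Hinv ∘L G))) := by
  obtain ⟨hκ0, hκ1⟩ := hκ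
  have hD : 0 < (1 - κ ^ 2) * ℓ₀ * τR ^ 2 + 1 := by
    have : 0 < 1 - κ ^ 2 := by nlinarith
    positivity
  have hcoeff : |2 * τR * τI| ≤ 2 * κ * τR ^ 2 := by
    rw [abs_mul, abs_of_nonneg (by linarith : (0 : ℝ) ≤ 2 * τR)]
    nlinarith
  have hcomp : ‖Hinv ∘L G‖ ≤ ((1 - κ ^ 2) * ℓ₀ * τR ^ 2 + 1)⁻¹ * m₀ :=
    (Hinv.opNorm_comp_le G).trans (by gcongr)
  have hbound : ‖((2 * τR * τI : ℝ) : ℂ) • (Hinv ∘L G)‖ ≤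
      2 * κ * m₀ * τR ^ 2 / ((1 - κ ^ 2) * ℓ₀ * τR ^ 2 + 1) := by
    rw [norm_smul, Complex.norm_real, Real.norm_eq_abs]
    calc |2 * τR * τI| * ‖Hinv ∘L G‖
        ≤ 2 * κ * τR ^ 2 * (((1 - κ ^ 2) * ℓ₀ * τR ^ 2 + 1)⁻¹ * m₀) := by gcongr
      _ = 2 * κ * m₀ * τR ^ 2 / ((1 - κ ^ 2) * ℓ₀ * τR ^ 2 + 1) := by
        rw [div_eq_mul_inv]; ring
  refine ⟨hbound, fun hsmall => ?_⟩
  have hlt : ‖-((2 * Complex.I * (τR : ℂ) * (τI : ℂ)) • (Hinv ∘L G))‖ < 1 := by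
    have hI : (2 * Complex.I * (τR : ℂ) * (τI : ℂ)) • (Hinv ∘L G) =
        Complex.I • ((2 * τR * τI : ℝ) : ℂ) • (Hinv ∘L G) := by
      rw [smul_smul]
      congr 1
      push_cast
      ring
    rw [norm_neg, hI, norm_smul, Complex.norm_I, one_mul]
    refine hbound.trans_lt ((div_lt_one hD).2 ?_)
    nlinarith [mul_le_mul_of_nonneg_right hsmall.le (sq_nonneg τR)]
  simpa only [sub_neg_eq_add] using isUnit_one_sub_of_norm_lt_one hlt
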